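/- VC-subgraph bound for the union of histogram-transform function classes: let d ≥ 1 be an integer, M > 0, and h₀ ∈ (0,1]. Let 𝓕 be the set of all functions f : ℝ^d → ℝ for which there exist s ∈ (0, 1/h₀] (i.e., bin width 1/s ≥ h₀), a d×d real orthogonal matrix R (Rᵀ R = I), b ∈ ℝ^d, and a map c : ℤ^d → [−M, M] such that f(x) = c(⌊s·(R x) + b⌋) for all x ∈ ℝ^d, where ⌊·⌋ is the componentwise integer floor; that is, 𝓕 is the union over all histogram transforms with bin width at least h₀ of the classes of functions constant on each histogram cell with values in [−M, M]. For f ∈ 𝓕 let sg(f) := {(x,t) ∈ ℝ^d × ℝ : t < f(x)} be its subgraph. Then no finite set D ⊆ [0,1]^d × [−M, M] of cardinality at least (d+1) · 2^{d+1} · (⌊√d / h₀⌋ + 1)^d is shattered by the subgraphs of 𝓕: for every such D there exists a subset D₀ ⊆ D such that no f ∈ 𝓕 satisfies sg(f) ∩ D = D₀. -/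

import Mathlib

open Matrix

/-- Halfspaces in `ℝ^d`, with a prescribed offset at each point, cut out every subset of no
family of `d + 2` points. -/
lemma exists_subset_forall_affine_ne {ι : Type*} {d : ℕ} (x : ι → Fin d → ℝ)
    (h : ι → ℝ) (S : Finset ι) (hS : d + 2 ≤ S.card) :
    ∃ T ⊆ S, ∀ (r : Fin d → ℝ) (b : ℝ), ¬ ∀ p ∈ S, (p ∈ T ↔ h p ≤ r ⬝ᵥ x p + b) := by
  classical
  have hdep : ¬ LinearIndependent ℝ (fun p : S => ((x p, 1) : (Fin d → ℝ) × ℝ)) := by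
    intro hl
    have := hl.fintype_card_le_finrank
    simp at this
    omega
  obtain ⟨g, hg, p₀, hp₀⟩ := Fintype.not_linearIndependent_iff.1 hdep
  obtain ⟨l, hl1, hlx, hlh, hl0⟩ : ∃ l : S → ℝ, ∑ p, l p = 0 ∧
      (∀ j, ∑ p, l p * x p j = 0) ∧ 0 ≤ ∑ p, l p * h p ∧ l p₀ ≠ 0 := by
    have h1 : ∑ p, g p = 0 := by
      have := congrArg Prod.snd hg
      simpa [Prod.snd_sum] using this
    have h2 : ∀ j, ∑ p, g p * x p j = 0 := by
      intro j
      have := congrFun (congrArg Prod.fst hg) j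
      simpa [Prod.fst_sum] using this
    rcases le_total 0 (∑ p, g p * h p) with h3 | h3
    · exact ⟨g, h1, h2, h3, hp₀⟩
    · refine ⟨-g, ?_, ?_, ?_, ?_⟩
      · simpa using h1
      · simpa using h2
      · simpa using h3
      · simpa using hp₀
  refine ⟨S.filter fun p => ∀ hp : p ∈ S, 0 ≤ l ⟨p, hp⟩, Finset.filter_subset _ _, ?_⟩
  intro r b hrb
  have key : ∀ p : S, (0 ≤ l p ↔ h p ≤ r ⬝ᵥ x p + b) := by
    intro p
    rw [← hrb p p.2]
    simp
  have hzero : ∑ p : S, l p * (r ⬝ᵥ x p + b - h p) = - ∑ p, l p * h p := by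
    have : ∑ p : S, l p * (r ⬝ᵥ x p) = 0 := by
      simp only [dotProduct, Finset.mul_sum]
      rw [Finset.sum_comm]
      refine Finset.sum_eq_zero fun j _ => ?_
      rw [← mul_zero (r j), ← hlx j, Finset.mul_sum]
      exact Finset.sum_congr rfl fun p _ => by ring
    simp only [mul_sub, mul_add, Finset.sum_sub_distrib, Finset.sum_add_distrib, this,
      ← Finset.sum_mul, hl1]
    ring
  obtain ⟨p₁, -, hp₁⟩ : ∃ p ∈ Finset.univ, l p < 0 := by
    by_contra! hcon
    exact hl0 ((Finset.sum_eq_zero_iff_of_nonneg hcon).1 hl1 p₀ (Finset.mem_univ _))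
  have hpos : 0 < ∑ p : S, l p * (r ⬝ᵥ x p + b - h p) := by
    refine Finset.sum_pos' (fun p _ => ?_) ⟨p₁, Finset.mem_univ _, ?_⟩
    · rcases le_or_gt 0 (l p) with hp | hp
      · exact mul_nonneg hp (sub_nonneg.2 ((key p).1 hp))
      · have := (key p).not.1 (not_le.2 hp)
        nlinarith
    · have := (key p₁).not.1 (not_le.2 hp₁)
      exact mul_pos_of_neg_of_neg hp₁ (by linarith)
  linarith

lemma sum_choose_le_succ_pow (N k : ℕ) : ∑ j ∈ Finset.Iic k, N.choose j ≤ (N + 1) ^ k := by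
  rw [add_pow, show Finset.Iic k = Finset.range (k + 1) by ext; simp]
  refine Finset.sum_le_sum fun j hj => ?_
  have hjk : j ≤ k := by simpa [Nat.lt_succ_iff] using hj
  calc N.choose j ≤ N ^ j := Nat.choose_le_pow N j
    _ ≤ N ^ j * 1 ^ (k - j) * k.choose j := by
      simpa using Nat.le_mul_of_pos_right _ (Nat.choose_pos hjk)

/-- The number of integer roundings, with values in `{0, …, K}`, of affine functions on a finite
family of points of `ℝ^d`. -/
lemma card_floor_affine_le {ι : Type*} [Fintype ι] {d : ℕ} (x : ι → Fin d → ℝ) (K : ℕ)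
    (G : Finset (ι → Fin (K + 1)))
    (hG : ∀ g ∈ G, ∃ (r : Fin d → ℝ) (b : ℝ), ∀ p, ((g p : ℕ) : ℤ) = ⌊r ⬝ᵥ x p + b⌋) :
    G.card ≤ (Fintype.card ι * K + 1) ^ (d + 1) := by
  classical
  let E : (ι → Fin (K + 1)) → Finset (ι × Fin K) := fun g =>
    Finset.univ.filter fun q => (q.2 : ℕ) + 1 ≤ g q.1
  have hE : Function.Injective E := by
    intro g g' hgg
    funext p
    by_contra hne
    have hmem : ∀ k : Fin K, (k : ℕ) + 1 ≤ g p ↔ (k : ℕ) + 1 ≤ g' p := fun k => by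
      have := Finset.ext_iff.1 hgg (p, k)
      simpa [E] using this
    rcases lt_or_gt_of_ne hne with hlt | hlt
    · have := hmem ⟨g p, by omega⟩
      simp only at this
      omega
    · have := hmem ⟨g' p, by omega⟩
      simp only at this
      omega
  have hvc : (G.image E).vcDim ≤ d + 1 := by
    refine Finset.sup_le fun S hS => ?_
    rw [Finset.mem_shatterer] at hS
    by_contra! hcard
    obtain ⟨T, hT, hne⟩ := exists_subset_forall_affine_ne (fun q : ι × Fin K => x q.1)
      (fun q => ((q.2 : ℕ) : ℝ) + 1) S hcard
    obtain ⟨U, hU, rfl⟩ := hS hT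
    obtain ⟨g, hg, rfl⟩ := Finset.mem_image.1 hU
    obtain ⟨r, b, hrb⟩ := hG g hg
    refine hne r b fun q hq => ?_
    have : ((q.2 : ℕ) + 1 ≤ (g q.1 : ℕ)) ↔ (((q.2 : ℕ) + 1 : ℤ) ≤ ((g q.1 : ℕ) : ℤ)) := by
      norm_cast
    simp only [Finset.mem_inter, hq, true_and, E, Finset.mem_filter, Finset.mem_univ, this,
      hrb, Int.le_floor]
    push_cast
    rfl
  calc G.card = (G.image E).card := (Finset.card_image_of_injective _ hE).symm
    _ ≤ (G.image E).shatterer.card := Finset.card_le_card_shatterer _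
    _ ≤ ∑ k ∈ Finset.Iic (G.image E).vcDim, (Fintype.card (ι × Fin K)).choose k :=
      Finset.card_shatterer_le_sum_vcDim
    _ ≤ (Fintype.card (ι × Fin K) + 1) ^ (G.image E).vcDim := sum_choose_le_succ_pow _ _
    _ ≤ (Fintype.card ι * K + 1) ^ (d + 1) := by
      rw [Fintype.card_prod, Fintype.card_fin]
      exact Nat.pow_le_pow_right (Nat.succ_pos _) hvc

lemma succ_pow_four_le (n : ℕ) : (n + 1) ^ 4 ≤ 2 ^ (6 + n) := by
  have step : ∀ k, (k + 6 + 1) ^ 4 ≤ 2 ^ (6 + (k + 6)) := by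
    intro k
    induction k with
    | zero => norm_num
    | succ k ih =>
      rw [show 6 + (k + 1 + 6) = 6 + (k + 6) + 1 by ring, pow_succ]
      calc (k + 1 + 6 + 1) ^ 4 ≤ (k + 6 + 1) ^ 4 * 2 := by
            nlinarith [Nat.zero_le (k ^ 2), Nat.zero_le (k ^ 3), Nat.zero_le (k ^ 4)]
        _ ≤ 2 ^ (6 + (k + 6)) * 2 := by gcongr
  rcases lt_or_ge n 6 with h | h
  · interval_cases n <;> norm_num
  · obtain ⟨k, rfl⟩ := Nat.exists_eq_add_of_le' h
    exact step k

/-- The number of subsets of `ι` which are cut out by a threshold on `t` in each fibre of `z`. -/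
lemma card_piecewise_threshold_pow_four_le {ι κ : Type*} [Fintype ι] [Fintype κ]
    (z : ι → κ) (t : ι → ℝ) (B : Finset (Finset ι))
    (hB : ∀ A ∈ B, ∃ c : κ → ℝ, ∀ p, p ∈ A ↔ t p < c (z p)) :
    B.card ^ 4 ≤ 2 ^ (6 * Fintype.card κ + Fintype.card ι) := by
  classical
  let cell : κ → Finset ι := fun k => Finset.univ.filter fun p => z p = k
  let code : Finset ι → κ → ℕ := fun A k => (A ∩ cell k).card
  have hinj : Set.InjOn code B := by
    intro A hA A' hA' hcode
    obtain ⟨c, hc⟩ := hB A hA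
    obtain ⟨c', hc'⟩ := hB A' hA'
    have hcell : ∀ k, A ∩ cell k = A' ∩ cell k := by
      intro k
      have hk : (A ∩ cell k).card = (A' ∩ cell k).card := congrFun hcode k
      rcases le_total (c k) (c' k) with hle | hle
      · refine Finset.eq_of_subset_of_card_le (fun p hp => ?_) hk.ge
        simp only [cell, Finset.mem_inter, Finset.mem_filter, Finset.mem_univ, true_and,
          hc, hc'] at hp ⊢
        obtain ⟨hp, rfl⟩ := hp
        exact ⟨hp.trans_le hle, rfl⟩
      · refine (Finset.eq_of_subset_of_card_le (fun p hp => ?_) hk.le).symm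
        simp only [cell, Finset.mem_inter, Finset.mem_filter, Finset.mem_univ, true_and,
          hc, hc'] at hp ⊢
        obtain ⟨hp, rfl⟩ := hp
        exact ⟨hp.trans_le hle, rfl⟩
    ext p
    have := Finset.ext_iff.1 (hcell (z p)) p
    simpa [cell] using this
  have hle : B.card ≤ ∏ k, ((cell k).card + 1) := by
    calc B.card ≤ (Fintype.piFinset fun k => Finset.range ((cell k).card + 1)).card := by
          refine Finset.card_le_card_of_injOn code (fun A _ => ?_) hinj
          simp only [Finset.mem_coe, Fintype.mem_piFinset, Finset.mem_range, Nat.lt_succ_iff]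
          exact fun k => Finset.card_le_card Finset.inter_subset_right
      _ = _ := by simp
  have hsum : ∑ k, (cell k).card = Fintype.card ι :=
    (Finset.card_eq_sum_card_fiberwise (f := z) (t := Finset.univ) (by simp)).symm
  calc B.card ^ 4 ≤ (∏ k, ((cell k).card + 1)) ^ 4 := Nat.pow_le_pow_left hle 4
    _ = ∏ k, ((cell k).card + 1) ^ 4 := (Finset.prod_pow _ _ _).symm
    _ ≤ ∏ k, 2 ^ (6 + (cell k).card) := Finset.prod_le_prod' fun k _ => succ_pow_four_le _
    _ = 2 ^ (6 * Fintype.card κ + Fintype.card ι) := by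
      rw [Finset.prod_pow_eq_pow_sum, Finset.sum_add_distrib, hsum]
      simp [mul_comm]

lemma three_mul_cube_add_one_sq_lt {q : ℕ} (hq : 4 ≤ q) : (3 * q ^ 3 + 1) ^ 2 < 2 ^ q ^ 2 := by
  induction q, hq using Nat.le_induction with
  | base => norm_num
  | succ q hq ih =>
    have h1 : 3 * (q + 1) ^ 3 + 1 ≤ 2 * (3 * q ^ 3 + 1) := by
      nlinarith [mul_le_mul hq hq (by norm_num) (by omega)]
    calc (3 * (q + 1) ^ 3 + 1) ^ 2 ≤ (2 * (3 * q ^ 3 + 1)) ^ 2 := Nat.pow_le_pow_left h1 2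
      _ = (3 * q ^ 3 + 1) ^ 2 * 2 ^ 2 := by ring
      _ < 2 ^ q ^ 2 * 2 ^ 2 := by gcongr
      _ ≤ 2 ^ q ^ 2 * 2 ^ (2 * q + 1) := by gcongr <;> omega
      _ = 2 ^ (q + 1) ^ 2 := by rw [← pow_add]; ring_nf

lemma succ_mul_pow_add_one_pow_lt {d q : ℕ} (hd : 2 ≤ d) (hq : 4 ≤ q) :
    ((d + 1) * q ^ (d + 1) + 1) ^ (2 * (d + 1)) < 8 ^ q ^ d := by
  induction d, hd using Nat.le_induction with
  | base =>
    calc ((2 + 1) * q ^ (2 + 1) + 1) ^ (2 * (2 + 1)) = ((3 * q ^ 3 + 1) ^ 2) ^ 3 := by ring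
      _ < (2 ^ q ^ 2) ^ 3 := Nat.pow_lt_pow_left (three_mul_cube_add_one_sq_lt hq) (by norm_num)
      _ = 8 ^ q ^ 2 := by rw [← pow_mul, mul_comm, pow_mul]; norm_num
  | succ d hd ih =>
    have h1 : (d + 1 + 1) * q ^ (d + 1 + 1) + 1 ≤ ((d + 1) * q ^ (d + 1) + 1) ^ 2 := by
      have h2 : d + 1 + 1 ≤ (d + 1) ^ 2 := by nlinarith
      have h3 : q ^ (d + 1 + 1) ≤ q ^ (2 * (d + 1)) := Nat.pow_le_pow_right (by omega) (by omega)
      calc _ ≤ (d + 1) ^ 2 * q ^ (2 * (d + 1)) + 1 := by gcongr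
        _ = ((d + 1) * q ^ (d + 1)) ^ 2 + 1 := by rw [mul_pow, ← pow_mul, mul_comm 2]
        _ ≤ _ := by nlinarith [Nat.zero_le ((d + 1) * q ^ (d + 1))]
    calc _ ≤ (((d + 1) * q ^ (d + 1) + 1) ^ 2) ^ (2 * (d + 1 + 1)) := Nat.pow_le_pow_left h1 _
      _ ≤ ((d + 1) * q ^ (d + 1) + 1) ^ (2 * (d + 1) * 4) := by
        rw [← pow_mul]
        exact Nat.pow_le_pow_right (Nat.succ_pos _) (by omega)
      _ < (8 ^ q ^ d) ^ 4 := by rw [pow_mul]; exact Nat.pow_lt_pow_left ih (by norm_num)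
      _ ≤ 8 ^ q ^ (d + 1) := by
        rw [← pow_mul, pow_succ]
        exact Nat.pow_le_pow_right (by norm_num) (by gcongr)

/-- Each coordinate of a histogram transform with `s √d < K` meets at most `K + 1` consecutive
integers on the unit cube. -/
lemma exists_fin_eq_floor {ι : Type*} [Finite ι] [Nonempty ι] {d K : ℕ} (x : ι → Fin d → ℝ)
    (hx : ∀ p, x p ∈ Set.Icc (0 : Fin d → ℝ) 1) {s : ℝ} (hs : 0 < s) (hK : s * √d < K)
    (u : Fin d → ℝ) (hu : u ⬝ᵥ u = 1) (b : ℝ) :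
    ∃ (g : ι → Fin (K + 1)) (k : ℤ), (∀ p, ⌊s * (u ⬝ᵥ x p) + b⌋ = k + ((g p : ℕ) : ℤ)) ∧
      ∀ p, ((g p : ℕ) : ℤ) = ⌊(s • u) ⬝ᵥ x p + (b - k)⌋ := by
  obtain ⟨q, hq⟩ := Finite.exists_min fun p => ⌊s * (u ⬝ᵥ x p) + b⌋
  have hdiff : ∀ p, u ⬝ᵥ x p - u ⬝ᵥ x q ≤ √d := by
    intro p
    rw [← dotProduct_sub]
    refine Real.le_sqrt_of_sq_le ?_
    have hcs := Finset.sum_mul_sq_le_sq_mul_sq Finset.univ u (x p - x q)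
    have h1 : ∑ i, u i ^ 2 = 1 := by rw [← hu]; simp [dotProduct, sq]
    have h2 : ∑ i, (x p - x q) i ^ 2 ≤ d := by
      calc ∑ i, (x p - x q) i ^ 2 ≤ ∑ i : Fin d, (1 : ℝ) := by
            refine Finset.sum_le_sum fun i _ => ?_
            have hp1 := (hx p).1 i
            have hp2 := (hx p).2 i
            have hq1 := (hx q).1 i
            have hq2 := (hx q).2 i
            simp only [Pi.zero_apply, Pi.one_apply, Pi.sub_apply] at *
            nlinarith
        _ = d := by simp
    rw [h1, one_mul] at hcs
    exact hcs.trans h2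
  have hlt : ∀ p, ⌊s * (u ⬝ᵥ x p) + b⌋ < ⌊s * (u ⬝ᵥ x q) + b⌋ + (K + 1) := by
    intro p
    rw [Int.floor_lt]
    push_cast
    have h1 := Int.lt_floor_add_one (s * (u ⬝ᵥ x q) + b)
    have h2 := mul_le_mul_of_nonneg_left (hdiff p) hs.le
    linarith
  have hkey : ∀ p, ⌊s * (u ⬝ᵥ x p) + b⌋ = ⌊s * (u ⬝ᵥ x q) + b⌋ +
      (((⌊s * (u ⬝ᵥ x p) + b⌋ - ⌊s * (u ⬝ᵥ x q) + b⌋).toNat : ℕ) : ℤ) := by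
    intro p
    have := hq p
    omega
  refine ⟨fun p => ⟨(⌊s * (u ⬝ᵥ x p) + b⌋ - ⌊s * (u ⬝ᵥ x q) + b⌋).toNat, ?_⟩,
    ⌊s * (u ⬝ᵥ x q) + b⌋, hkey, fun p => ?_⟩
  · have := hlt p
    omega
  · rw [smul_dotProduct, smul_eq_mul, ← add_sub_assoc, Int.floor_sub_intCast]
    have := hkey p
    simp only
    omega

/-- `A` is cut out by a threshold on `t` in each cell of an affine grid with at most `K + 1` cells
in each coordinate. -/
def IsGridThreshold {ι : Type*} {d : ℕ} (x : ι → Fin d → ℝ) (t : ι → ℝ) (K : ℕ)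
    (A : Finset ι) : Prop :=
  ∃ (g : Fin d → ι → Fin (K + 1)) (c : (Fin d → Fin (K + 1)) → ℝ),
    (∀ i, ∃ (r : Fin d → ℝ) (b : ℝ), ∀ p, ((g i p : ℕ) : ℤ) = ⌊r ⬝ᵥ x p + b⌋) ∧
    ∀ p, p ∈ A ↔ t p < c fun i => g i p

lemma exists_not_isGridThreshold_of_two_le {ι : Type*} [Fintype ι] {d K : ℕ} (hd : 2 ≤ d)
    (hK : 2 ≤ K) (hι : Fintype.card ι = (d + 1) * 2 ^ (d + 1) * K ^ d)
    (x : ι → Fin d → ℝ) (t : ι → ℝ) : ∃ A, ¬ IsGridThreshold x t K A := by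
  classical
  by_contra! hA
  obtain ⟨n, hn⟩ : ∃ n, (2 * K) ^ d = 2 * n :=
    (dvd_pow_self 2 (by omega)).trans (pow_dvd_pow_of_dvd (dvd_mul_right 2 K) d)
  have hm : Fintype.card ι = 2 * (d + 1) * (2 * n) := by
    rw [hι, ← hn, mul_pow]; ring
  let G : Finset (ι → Fin (K + 1)) := Finset.univ.filter fun g =>
    ∃ (r : Fin d → ℝ) (b : ℝ), ∀ p, ((g p : ℕ) : ℤ) = ⌊r ⬝ᵥ x p + b⌋
  let B : (Fin d → ι → Fin (K + 1)) → Finset (Finset ι) := fun g => Finset.univ.filter fun A =>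
    ∃ c : (Fin d → Fin (K + 1)) → ℝ, ∀ p, p ∈ A ↔ t p < c fun i => g i p
  have hG : G.card < 2 ^ (3 * n) := by
    have h1 : G.card ≤ (Fintype.card ι * K + 1) ^ (d + 1) :=
      card_floor_affine_le x K G fun g hg => (Finset.mem_filter.1 hg).2
    have h2 : Fintype.card ι * K = (d + 1) * (2 * K) ^ (d + 1) := by
      rw [hι, mul_pow]; ring
    refine lt_of_pow_lt_pow_left₀ 2 (Nat.zero_le _) ?_
    calc G.card ^ 2 ≤ ((Fintype.card ι * K + 1) ^ (d + 1)) ^ 2 := Nat.pow_le_pow_left h1 2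
      _ = ((d + 1) * (2 * K) ^ (d + 1) + 1) ^ (2 * (d + 1)) := by
        rw [h2, ← pow_mul, mul_comm (d + 1) 2]
      _ < 8 ^ (2 * K) ^ d := succ_mul_pow_add_one_pow_lt hd (by omega)
      _ = (2 ^ (3 * n)) ^ 2 := by
        rw [hn, ← pow_mul, show 3 * n * 2 = 3 * (2 * n) by ring, pow_mul 2 3]; norm_num
  have hB : ∀ g, (B g).card ≤ 2 ^ (n * (d + 4)) := by
    intro g
    refine le_of_pow_le_pow_left₀ (n := 4) (by norm_num) (Nat.zero_le _) ?_
    have hcells : Fintype.card (Fin d → Fin (K + 1)) ≤ 2 * n := by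
      rw [← hn]
      simpa using Nat.pow_le_pow_left (show K + 1 ≤ 2 * K by omega) d
    calc (B g).card ^ 4 ≤ 2 ^ (6 * Fintype.card (Fin d → Fin (K + 1)) + Fintype.card ι) :=
          card_piecewise_threshold_pow_four_le (fun p i => g i p) t _
            fun A hA => (Finset.mem_filter.1 hA).2
      _ ≤ (2 ^ (n * (d + 4))) ^ 4 := by
        rw [← pow_mul, hm]
        refine Nat.pow_le_pow_right (by norm_num) ?_
        nlinarith
  have hcover : (Finset.univ : Finset (Finset ι)) ⊆
      (Fintype.piFinset fun _ : Fin d => G).biUnion B := by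
    intro A _
    obtain ⟨g, c, hg, hc⟩ := hA A
    simp only [Finset.mem_biUnion, Fintype.mem_piFinset]
    exact ⟨g, fun i => Finset.mem_filter.2 ⟨Finset.mem_univ _, hg i⟩,
      Finset.mem_filter.2 ⟨Finset.mem_univ _, c, hc⟩⟩
  have hcount : 2 ^ (2 * (d + 1) * (2 * n)) ≤ G.card ^ d * 2 ^ (n * (d + 4)) := by
    calc 2 ^ (2 * (d + 1) * (2 * n)) = (Finset.univ : Finset (Finset ι)).card := by
          rw [Finset.card_univ, Fintype.card_finset, hm]
      _ ≤ ((Fintype.piFinset fun _ : Fin d => G).biUnion B).card := Finset.card_le_card hcover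
      _ ≤ (Fintype.piFinset fun _ : Fin d => G).card * 2 ^ (n * (d + 4)) :=
        Finset.card_biUnion_le_card_mul _ _ _ fun g _ => hB g
      _ = G.card ^ d * 2 ^ (n * (d + 4)) := by simp
  have hlt : G.card ^ d * 2 ^ (n * (d + 4)) < 2 ^ (2 * (d + 1) * (2 * n)) := by
    calc G.card ^ d * 2 ^ (n * (d + 4)) < (2 ^ (3 * n)) ^ d * 2 ^ (n * (d + 4)) :=
          Nat.mul_lt_mul_of_pos_right (Nat.pow_lt_pow_left hG (by omega)) (by positivity)
      _ = 2 ^ (2 * (d + 1) * (2 * n)) := by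
        rw [← pow_mul, ← pow_add]; ring_nf
  omega

lemma exists_not_isGridThreshold_of_eq_one {ι : Type*} [Fintype ι] {K : ℕ} (hK : 1 ≤ K)
    (hι : Fintype.card ι = 8 * K) (x : ι → Fin 1 → ℝ) (t : ι → ℝ) :
    ∃ A, ¬ IsGridThreshold x t K A := by
  classical
  obtain ⟨e, he⟩ : ∃ e : Fin (8 * K) ≃ ι, Monotone fun j => x (e j) 0 :=
    let e₀ := (Fintype.equivFinOfCardEq hι).symm
    ⟨(Tuple.sort fun j => x (e₀ j) 0).trans e₀, Tuple.monotone_sort fun j => x (e₀ j) 0⟩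
  let first : Fin (4 * K) → ι := fun j => e ⟨2 * j, by omega⟩
  let second : Fin (4 * K) → ι := fun j => e ⟨2 * j + 1, by omega⟩
  refine ⟨Finset.univ.filter fun p => ∃ j, p = first j ∧ t (second j) ≤ t p ∨
    p = second j ∧ t (first j) < t p, ?_⟩
  rintro ⟨g, c, hg, hc⟩
  have hfirst : ∀ j j', first j = first j' ↔ j = j' := fun j j' => by
    simp [first, Fin.ext_iff]
  have hsecond : ∀ j j', second j = second j' ↔ j = j' := fun j j' => by
    simp [second, Fin.ext_iff]
  have hfs : ∀ j j', first j ≠ second j' := fun j j' => by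
    simp only [first, second, ne_eq, EmbeddingLike.apply_eq_iff_eq, Fin.mk.injEq]
    omega
  have hne : ∀ j, g 0 (first j) ≠ g 0 (second j) := by
    intro j hj
    have h1 := hc (first j)
    have h2 := hc (second j)
    have hcell : (fun i => g i (first j)) = fun i => g i (second j) := by
      funext i; rw [Subsingleton.elim i 0, hj]
    rw [hcell] at h1
    simp only [Finset.mem_filter, Finset.mem_univ, true_and, hfirst, hsecond, hfs,
      (hfs _ _).symm, false_and, or_false, false_or] at h1 h2
    simp only [exists_eq_left'] at h1 h2
    rcases le_or_gt (t (second j)) (t (first j)) with h | h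
    · exact (h2.not.1 h.not_gt) (h.trans_lt (h1.1 h))
    · exact (h1.not.1 h.not_ge) (h.trans (h2.1 h))
  obtain ⟨r, b, hrb⟩ := hg 0
  have hrb' : ∀ p, ((g 0 p : ℕ) : ℤ) = ⌊r 0 * x p 0 + b⌋ := by simpa [dotProduct] using hrb
  obtain ⟨a, ha, haK, hamono⟩ : ∃ a : ι → ℕ, (∀ j, a (first j) ≠ a (second j)) ∧
      (∀ p, a p ≤ K) ∧ Monotone fun j => a (e j) := by
    rcases le_total 0 (r 0) with hr | hr
    · refine ⟨fun p => g 0 p, fun j => Fin.val_injective.ne (hne j),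
        fun p => Nat.lt_succ_iff.1 (g 0 p).2, ?_⟩
      intro j j' hj
      have : ((g 0 (e j) : ℕ) : ℤ) ≤ ((g 0 (e j') : ℕ) : ℤ) := by
        rw [hrb', hrb']
        exact Int.floor_le_floor (add_le_add_left (mul_le_mul_of_nonneg_left (he hj) hr) b)
      exact_mod_cast this
    · refine ⟨fun p => K - g 0 p, fun j => ?_, fun p => Nat.sub_le _ _, ?_⟩
      · have := Fin.val_injective.ne (hne j)
        simp only at this ⊢
        omega
      intro j j' hj
      have : ((g 0 (e j') : ℕ) : ℤ) ≤ ((g 0 (e j) : ℕ) : ℤ) := by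
        rw [hrb', hrb']
        exact Int.floor_le_floor (add_le_add_left (mul_le_mul_of_nonpos_left (he hj) hr) b)
      simp only
      omega
  have hgrow : ∀ j (hj : j < 4 * K), j < a (second ⟨j, hj⟩) := by
    intro j
    have hstep : ∀ j : Fin (4 * K), a (first j) < a (second j) := fun j =>
      lt_of_le_of_ne (hamono (Fin.mk_le_mk.2 (Nat.le_succ _))) (ha j)
    induction j with
    | zero => exact fun hj => (Nat.zero_le _).trans_lt (hstep _)
    | succ j ih =>
      intro hj
      have h1 := ih (by omega)
      have h2 : a (second ⟨j, by omega⟩) ≤ a (first ⟨j + 1, hj⟩) :=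
        hamono (Fin.mk_le_mk.2 (by simp only; omega))
      have h3 := hstep ⟨j + 1, hj⟩
      omega
  have h1 := hgrow K (by omega)
  have h2 := haK (second ⟨K, by omega⟩)
  omega

/-- VC-subgraph bound for the union `𝓕` of histogram-transform function
classes with orthogonal rotations, bin widths at least `h₀`, and values in
`[-M, M]`: no finite subset of `[0,1]^d × [-M,M]` of cardinality at least
`(d+1)·2^(d+1)·(⌊√d/h₀⌋+1)^d` is shattered by the subgraphs of `𝓕`. -/
theorem stmt_14 (d : ℕ) (hd : 1 ≤ d) (M h₀ : ℝ) (hM : 0 < M)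
    (hh₀ : h₀ ∈ Set.Ioc (0 : ℝ) 1)
    (F : Set ((Fin d → ℝ) → ℝ))
    (hF : F = {f | ∃ (s : ℝ) (R : Matrix (Fin d) (Fin d) ℝ) (b : Fin d → ℝ)
        (c : (Fin d → ℤ) → ℝ),
        0 < s ∧ s ≤ 1 / h₀ ∧ Rᵀ * R = 1 ∧ (∀ z, c z ∈ Set.Icc (-M) M) ∧
        ∀ x, f x = c fun i => ⌊s * (R.mulVec x) i + b i⌋})
    (D : Finset ((Fin d → ℝ) × ℝ))
    (hD : ↑D ⊆ (Set.Icc (0 : Fin d → ℝ) 1) ×ˢ Set.Icc (-M) M)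
    (hcard : (d + 1) * 2 ^ (d + 1) * (⌊Real.sqrt d / h₀⌋₊ + 1) ^ d ≤ D.card) :
    ∃ D₀ ⊆ D, ∀ f ∈ F,
      {p : (Fin d → ℝ) × ℝ | p.2 < f p.1} ∩ ↑D ≠ ↑D₀ := by
  subst hF
  obtain ⟨hh0, hh1⟩ := hh₀
  set K := ⌊√(d : ℝ) / h₀⌋₊ + 1 with hKdef
  have hlt : √(d : ℝ) / h₀ < K := by
    rw [hKdef]; push_cast; exact Nat.lt_floor_add_one _
  have hK : 2 ≤ K := by
    have hd' : (1 : ℝ) ≤ √(d : ℝ) := Real.one_le_sqrt.2 (by exact_mod_cast hd)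
    have : 1 ≤ ⌊√(d : ℝ) / h₀⌋₊ := Nat.le_floor (by
      rw [Nat.cast_one, le_div_iff₀ hh0]; linarith)
    omega
  obtain ⟨D', hD', hcard'⟩ := Finset.exists_subset_card_eq hcard
  have hne : Nonempty D' := by
    rw [Finset.nonempty_coe_sort, ← Finset.card_pos, hcard']
    positivity
  have hι : Fintype.card D' = (d + 1) * 2 ^ (d + 1) * K ^ d := by
    rw [Fintype.card_coe, hcard']
  obtain ⟨A, hA⟩ : ∃ A : Finset D',
      ¬ IsGridThreshold (fun p : D' => p.1.1) (fun p => p.1.2) K A := by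
    rcases hd.eq_or_lt with rfl | hd2
    · exact exists_not_isGridThreshold_of_eq_one (by omega) (by rw [hι]; ring) _ _
    · exact exists_not_isGridThreshold_of_two_le hd2 hK hι _ _
  refine ⟨A.map (Function.Embedding.subtype _), fun p hp => ?_, ?_⟩
  · obtain ⟨q, -, rfl⟩ := Finset.mem_map.1 hp
    exact hD' q.2
  rintro f ⟨s, R, b, c, hs, hsh, hR, -, hf⟩ heq
  apply hA
  have hsK : s * √(d : ℝ) < K := by
    refine lt_of_le_of_lt ?_ hlt
    calc s * √(d : ℝ) ≤ 1 / h₀ * √(d : ℝ) := by gcongr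
      _ = √(d : ℝ) / h₀ := by ring
  have hrow : ∀ i, R i ⬝ᵥ R i = 1 := fun i => by
    have := congrFun (congrFun (_root_.mul_eq_one_comm.1 hR : R * Rᵀ = 1) i) i
    simpa [Matrix.mul_apply, dotProduct] using this
  choose g k hg hgfloor using fun i => exists_fin_eq_floor (fun p : D' => p.1.1)
    (fun p => (hD (hD' p.2)).1) hs hsK (R i) (hrow i) (b i)
  refine ⟨g, fun z => c fun i => k i + ((z i : ℕ) : ℤ), fun i => ⟨_, _, hgfloor i⟩, fun p => ?_⟩
  have hmem := Set.ext_iff.1 heq p.1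
  have hfp : f p.1.1 = c fun i => k i + ((g i p : ℕ) : ℤ) := by
    rw [hf]
    congr 1
    funext i
    exact hg i p
  simp only [← hfp]
  simpa [hD' p.2] using hmem.symm
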